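/- arXiv:1606.02691 — 2 statements merged into one kernel-verified Lean document; each statement's English description precedes it below -/
import Mathlib

section
/- There is a constant C' depending only on n (and the profile g) such that for every finite nonzero Borel measure μ on ℝ^N, every measurable f : ℝ^N → ℝ with |f(y)| ≤ K for μ-a.e. y, every ε > 0, and every x ∈ ℝ^N: the ε-mollification f_ε of f with respect to μ is differentiable at x, |f_ε(x)| ≤ K, and ‖Df_ε(x)‖ ≤ C' · ε^{−(n+2)} · K. -/
open MeasureTheory Filter Topology

/-- The smooth bump profile `g(t) = exp(1/(t² − 1))` for `t < 1`, `0` for `t ≥ 1`. -/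
noncomputable def gProfile (t : ℝ) : ℝ :=
  if t < 1 then Real.exp (1 / (t ^ 2 - 1)) else 0

/-- The mollifier `φ_ε(x) = C · ε^{−n} · g(‖x‖/ε)` on `ℝ^N`, supported in the
ball of radius `ε`; `C` is a fixed normalizing constant. -/
noncomputable def molKernel (N n : ℕ) (C ε : ℝ) (x : EuclideanSpace ℝ (Fin N)) : ℝ :=
  C * ε ^ (-(n : ℤ)) * gProfile (‖x‖ / ε)

/-- The `ε`-mollification of `f` with respect to the measure `μ`:
`f_ε(x) = (∫ f(y) φ_ε(x − y) dμ(y)) / (∫ φ_ε(x − z) dμ(z) + ε·μ(ℝ^N))`. -/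
noncomputable def mollify (N n : ℕ) (C : ℝ) (μ : Measure (EuclideanSpace ℝ (Fin N)))
    (ε : ℝ) (f : EuclideanSpace ℝ (Fin N) → ℝ) (x : EuclideanSpace ℝ (Fin N)) : ℝ :=
  (∫ y, f y * molKernel N n C ε (x - y) ∂μ) /
    ((∫ z, molKernel N n C ε (x - z) ∂μ) + ε * (μ Set.univ).toReal)

lemma gProfile_eq_expNegInvGlue {t : ℝ} (ht : 0 ≤ t) :
    gProfile t = expNegInvGlue (1 - t ^ 2) := by
  unfold gProfile expNegInvGlue
  by_cases h : t < 1
  · rw [if_pos h, if_neg (by nlinarith), ← neg_sub, one_div, inv_neg]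
  · rw [if_neg h, if_pos (by nlinarith)]

lemma gProfile_nonneg (t : ℝ) : 0 ≤ gProfile t := by
  unfold gProfile
  split_ifs <;> positivity

lemma gProfile_le_one {t : ℝ} (ht : 0 ≤ t) : gProfile t ≤ 1 := by
  unfold gProfile
  split_ifs with h
  · exact Real.exp_le_one_iff.2 (one_div_nonpos.2 (by nlinarith))
  · exact zero_le_one

/-- The even extension of the profile is Lipschitz on the real line. -/
lemma exists_lipschitzWith_expNegInvGlue_one_sub_sq :
    ∃ L : NNReal, LipschitzWith L fun t : ℝ => expNegInvGlue (1 - t ^ 2) := by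
  have hc : ContDiff ℝ 1 fun t : ℝ => expNegInvGlue (1 - t ^ 2) :=
    expNegInvGlue.contDiff.comp (contDiff_const.sub (contDiff_id.pow 2))
  have hs : HasCompactSupport fun t : ℝ => expNegInvGlue (1 - t ^ 2) := by
    refine HasCompactSupport.intro (isCompact_Icc (a := (-1 : ℝ)) (b := 1)) fun t ht => ?_
    refine expNegInvGlue.zero_of_nonpos ?_
    by_contra! h
    exact ht ⟨by nlinarith, by nlinarith⟩
  exact hc.lipschitzWith_of_hasCompactSupport hs one_ne_zero

lemma molKernel_eq (N n : ℕ) (C : ℝ) {ε : ℝ} (hε : 0 < ε) (x : EuclideanSpace ℝ (Fin N)) :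
    molKernel N n C ε x = C * ε ^ (-(n : ℤ)) * expNegInvGlue (1 - (‖x‖ / ε) ^ 2) := by
  rw [molKernel, gProfile_eq_expNegInvGlue (by positivity)]

lemma contDiff_molKernel (N n : ℕ) (C : ℝ) {ε : ℝ} (hε : 0 < ε) :
    ContDiff ℝ 1 (molKernel N n C ε) := by
  rw [funext (molKernel_eq N n C hε)]
  refine contDiff_const.mul (expNegInvGlue.contDiff.comp (contDiff_const.sub ?_))
  simp only [div_pow]
  exact (contDiff_norm_sq ℝ).div_const _

lemma molKernel_nonneg (N n : ℕ) {C ε : ℝ} (hC : 0 ≤ C) (hε : 0 < ε)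
    (x : EuclideanSpace ℝ (Fin N)) : 0 ≤ molKernel N n C ε x :=
  mul_nonneg (by positivity) (gProfile_nonneg _)

lemma abs_molKernel_le (N n : ℕ) {C ε : ℝ} (hC : 0 ≤ C) (hε : 0 < ε)
    (x : EuclideanSpace ℝ (Fin N)) : |molKernel N n C ε x| ≤ C * ε ^ (-(n : ℤ)) := by
  rw [abs_of_nonneg (molKernel_nonneg N n hC hε x)]
  exact mul_le_of_le_one_right (by positivity) (gProfile_le_one (by positivity))

lemma norm_fderiv_molKernel_le (N n : ℕ) {C ε : ℝ} (hC : 0 ≤ C) (hε : 0 < ε) {L : NNReal}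
    (hL : LipschitzWith L fun t : ℝ => expNegInvGlue (1 - t ^ 2))
    (x : EuclideanSpace ℝ (Fin N)) :
    ‖fderiv ℝ (molKernel N n C ε) x‖ ≤ C * ε ^ (-(n : ℤ)) * (L / ε) := by
  have h0 : 0 ≤ C * ε ^ (-(n : ℤ)) := by positivity
  refine norm_fderiv_le_of_lip' ℝ (by positivity) (Eventually.of_forall fun y => ?_)
  have h := hL.dist_le_mul (‖y‖ / ε) (‖x‖ / ε)
  rw [Real.dist_eq, Real.dist_eq, ← sub_div, abs_div, abs_of_pos hε] at h
  rw [molKernel_eq N n C hε, molKernel_eq N n C hε, ← mul_sub, norm_mul, Real.norm_eq_abs,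
    Real.norm_eq_abs, abs_of_nonneg h0, mul_assoc _ (L / ε : ℝ)]
  refine mul_le_mul_of_nonneg_left (h.trans ?_) h0
  calc (L : ℝ) * (|‖y‖ - ‖x‖| / ε) ≤ L * (‖y - x‖ / ε) := by
        gcongr
        exact abs_norm_sub_norm_le y x
    _ = L / ε * ‖y - x‖ := by ring

section Convolution

variable {E : Type*} [NormedAddCommGroup E] [MeasurableSpace E] [BorelSpace E] {μ : Measure E} [IsFiniteMeasure μ]
  {f ψ : E → ℝ} {K L b : ℝ}

lemma integrable_mul_comp_sub (hf : Measurable f) (hK : ∀ᵐ y ∂μ, |f y| ≤ K)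
    (hψ : Continuous ψ) (hb : ∀ v, |ψ v| ≤ b) (x : E) :
    Integrable (fun y => f y * ψ (x - y)) μ := by
  refine Integrable.of_bound (C := K * b) ?_ ?_
  · exact (hf.mul (hψ.comp (continuous_const.sub continuous_id)).measurable).aestronglyMeasurable
  · filter_upwards [hK] with y hy
    rw [norm_mul]
    exact mul_le_mul hy (hb _) (abs_nonneg _) ((abs_nonneg _).trans hy)

variable [NormedSpace ℝ E] [FiniteDimensional ℝ E]

/-- Integration of a `C¹` kernel with bounded derivative against a bounded function yields a
differentiable function, with the expected derivative bound. -/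
lemma exists_hasFDerivAt_integral_mul_comp_sub (hf : Measurable f)
    (hK : ∀ᵐ y ∂μ, |f y| ≤ K) (hψ : ContDiff ℝ 1 ψ) (hb : ∀ v, |ψ v| ≤ b)
    (hL : ∀ v, ‖fderiv ℝ ψ v‖ ≤ L) (x : E) :
    ∃ D : E →L[ℝ] ℝ, HasFDerivAt (fun x => ∫ y, f y * ψ (x - y) ∂μ) D x ∧
      ‖D‖ ≤ K * L * μ.real Set.univ := by
  have hbound : ∀ᵐ y ∂μ, ∀ x : E, ‖f y • fderiv ℝ ψ (x - y)‖ ≤ K * L := by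
    filter_upwards [hK] with y hy x
    rw [norm_smul]
    exact mul_le_mul hy (hL _) (norm_nonneg _) ((abs_nonneg _).trans hy)
  refine ⟨∫ y, f y • fderiv ℝ ψ (x - y) ∂μ, ?_, ?_⟩
  · refine hasFDerivAt_integral_of_dominated_of_fderiv_le
      (F' := fun x y => f y • fderiv ℝ ψ (x - y)) (bound := fun _ => K * L)
      (s := Set.univ) univ_mem ?_ (integrable_mul_comp_sub hf hK hψ.continuous hb x) ?_ ?_
      (integrable_const _) ?_
    · exact Eventually.of_forall fun x =>
        (integrable_mul_comp_sub hf hK hψ.continuous hb x).aestronglyMeasurable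
    · exact hf.aestronglyMeasurable.smul ((hψ.continuous_fderiv one_ne_zero).comp
        (continuous_const.sub continuous_id)).aestronglyMeasurable
    · filter_upwards [hbound] with y hy x _ using hy x
    · refine Eventually.of_forall fun y x _ => ?_
      have h := (hψ.differentiable one_ne_zero (x - y)).hasFDerivAt
      exact ((hasFDerivAt_comp_sub y).2 h).const_mul (f y)
  · exact norm_integral_le_of_norm_le_const (hbound.mono fun y hy => hy x)

end Convolution

/-- Uniform bound on the first derivative of a mollified function: there is a
constant `C'` (depending only on `n`, the profile `g` and the normalizing constant)
such that for every finite nonzero Borel measure `μ`, every measurable `f` with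
`|f| ≤ K` μ-a.e., every `ε > 0` and every `x`, the mollification `f_ε` is
differentiable at `x`, `|f_ε(x)| ≤ K`, and `‖Df_ε(x)‖ ≤ C' ε^{−(n+2)} K`. -/
theorem mollify_deriv_bound (n : ℕ) (hn : 1 ≤ n) (C : ℝ) (hC : 0 < C) :
    ∃ C' : ℝ, 0 < C' ∧
      ∀ (N : ℕ), 1 ≤ N →
      ∀ (μ : Measure (EuclideanSpace ℝ (Fin N))), IsFiniteMeasure μ → μ ≠ 0 →
      ∀ (f : EuclideanSpace ℝ (Fin N) → ℝ), Measurable f →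
      ∀ (K : ℝ), (∀ᵐ y ∂μ, |f y| ≤ K) →
      ∀ (ε : ℝ), 0 < ε →
      ∀ (x : EuclideanSpace ℝ (Fin N)),
        DifferentiableAt ℝ (mollify N n C μ ε f) x ∧
        |mollify N n C μ ε f x| ≤ K ∧
        ‖fderiv ℝ (mollify N n C μ ε f) x‖ ≤ C' * ε ^ (-(n : ℤ) - 2) * K := by
  obtain ⟨L, hL⟩ := exists_lipschitzWith_expNegInvGlue_one_sub_sq
  refine ⟨2 * C * (L + 1), by positivity, ?_⟩
  intro N _ μ hμ hμ0 f hf K hK ε hε x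
  have hM : 0 < μ.real Set.univ := by
    have : NeZero μ := ⟨hμ0⟩
    exact measureReal_univ_pos
  have hK0 : 0 ≤ K := by
    have : NeBot (ae μ) := ae_neBot.2 hμ0
    obtain ⟨y, hy⟩ := hK.exists
    exact (abs_nonneg _).trans hy
  have hψ := contDiff_molKernel N n C hε
  have hb := abs_molKernel_le N n hC.le hε
  have hD := norm_fderiv_molKernel_le N n hC.le hε hL
  have h1 : ∀ᵐ y ∂μ, |(fun _ : EuclideanSpace ℝ (Fin N) => (1 : ℝ)) y| ≤ 1 := by simp
  have hint := integrable_mul_comp_sub (μ := μ) measurable_const h1 hψ.continuous hb x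
  obtain ⟨DA, hA, hDA⟩ := exists_hasFDerivAt_integral_mul_comp_sub hf hK hψ hb hD x
  obtain ⟨DB, hB, hDB⟩ :=
    exists_hasFDerivAt_integral_mul_comp_sub measurable_const h1 hψ hb hD x
  simp only [one_mul] at hint hB hDB
  set A : EuclideanSpace ℝ (Fin N) → ℝ := fun x => ∫ y, f y * molKernel N n C ε (x - y) ∂μ
  set B : EuclideanSpace ℝ (Fin N) → ℝ :=
    fun x => (∫ y, molKernel N n C ε (x - y) ∂μ) + ε * μ.real Set.univ
  have hI : 0 ≤ ∫ y, molKernel N n C ε (x - y) ∂μ :=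
    integral_nonneg fun y => molKernel_nonneg N n hC.le hε _
  have hεM : 0 < ε * μ.real Set.univ := mul_pos hε hM
  have hBx : ε * μ.real Set.univ ≤ B x := le_add_of_nonneg_left hI
  have hBpos : 0 < B x := hεM.trans_le hBx
  have hAB : |A x| ≤ K * B x := by
    calc |A x| ≤ ∫ y, K * molKernel N n C ε (x - y) ∂μ := by
          rw [← Real.norm_eq_abs]
          refine norm_integral_le_of_norm_le (hint.const_mul K) ?_
          filter_upwards [hK] with y hy
          rw [norm_mul, Real.norm_eq_abs, Real.norm_eq_abs,
            abs_of_nonneg (molKernel_nonneg N n hC.le hε _)]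
          exact mul_le_mul_of_nonneg_right hy (molKernel_nonneg N n hC.le hε _)
      _ = K * ∫ y, molKernel N n C ε (x - y) ∂μ := integral_const_mul _ _
      _ ≤ K * B x := mul_le_mul_of_nonneg_left (le_add_of_nonneg_right hεM.le) hK0
  have hval : |A x / B x| ≤ K := by
    rwa [abs_div, abs_of_pos hBpos, div_le_iff₀ hBpos]
  have hquot : HasFDerivAt (mollify N n C μ ε f) ((B x)⁻¹ • (DA - (A x / B x) • DB)) x := by
    have h := hA.mul ((hasDerivAt_inv hBpos.ne').comp_hasFDerivAt x
      (hB.add_const (ε * μ.real Set.univ)))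
    have hfun : mollify N n C μ ε f = A * ((fun b : ℝ => b⁻¹) ∘ B) :=
      funext fun x => div_eq_mul_inv _ _
    rw [hfun]
    refine h.congr_fderiv ?_
    ext v
    change A x * (-(B x ^ 2)⁻¹ * DB v) + (B x)⁻¹ * DA v = (B x)⁻¹ * (DA v - A x / B x * DB v)
    field_simp
    ring
  refine ⟨hquot.differentiableAt, hval, ?_⟩
  rw [hquot.fderiv, norm_smul, norm_inv, Real.norm_of_nonneg hBpos.le]
  set T := C * ε ^ (-(n : ℤ)) * (L / ε) * μ.real Set.univ with hT
  have hT0 : 0 ≤ T := by positivity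
  have hsub : ‖DA - (A x / B x) • DB‖ ≤ 2 * K * T := by
    calc ‖DA - (A x / B x) • DB‖ ≤ ‖DA‖ + |A x / B x| * ‖DB‖ :=
          (norm_sub_le _ _).trans_eq (by rw [norm_smul, Real.norm_eq_abs])
      _ ≤ K * T + K * T := by
          rw [mul_assoc] at hDA
          gcongr
      _ = 2 * K * T := by ring
  calc (B x)⁻¹ * ‖DA - (A x / B x) • DB‖
      ≤ (ε * μ.real Set.univ)⁻¹ * (2 * K * T) := by gcongr
    _ = 2 * C * L * ε ^ (-(n : ℤ) - 2) * K := by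
        rw [hT, zpow_sub₀ hε.ne']
        field_simp
    _ ≤ 2 * C * (L + 1) * ε ^ (-(n : ℤ) - 2) * K := by
        gcongr
        exact le_add_of_nonneg_right zero_le_one
end

section
/- Let (μ_j) be a sequence of finite Borel measures on ℝ^N converging weakly to a finite Borel measure μ, let 1 < p < ∞ and C > 0, and let F_j : ℝ^N → ℝ^N be measurable with ‖F_j‖_{L^p(μ_j)} ≤ C. Then there exist a strictly increasing sequence of indices (j_k) and F ∈ L^p(μ; ℝ^N) with ‖F‖_{L^p(μ)} ≤ C such that for every continuous compactly supported φ : ℝ^N → ℝ, ∫ φ · F_{j_k} dμ_{j_k} → ∫ φ · F dμ (convergence of each ℝ^N-valued integral). -/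
open MeasureTheory Filter Topology
open scoped BoundedContinuousFunction ENNReal NNReal

theorem abs_sub_clamp_le {p L : ℝ} (hp : 1 < p) (hL : 0 < L) (t : ℝ) :
    |t - max (-L) (min L t)| ≤ |t| ^ p * L ^ (1 - p) := by
  rcases le_or_gt |t| L with h | h
  · obtain ⟨h1, h2⟩ := abs_le.1 h
    rw [min_eq_right h2, max_eq_right h1, sub_self, abs_zero]
    positivity
  · have ht : 0 < |t| := hL.trans h
    calc |t - max (-L) (min L t)| ≤ |t| := by
          rcases lt_abs.1 h with h' | h'
          · rw [min_eq_left h'.le, max_eq_right (by linarith), abs_of_pos (by linarith),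
              abs_of_pos (by linarith)]
            linarith
          · rw [min_eq_right (by linarith), max_eq_left (by linarith),
              abs_of_neg (by linarith), abs_of_neg (by linarith)]
            linarith
      _ = |t| ^ p * |t| ^ (1 - p) := by
          rw [← Real.rpow_add ht]; simp
      _ ≤ |t| ^ p * L ^ (1 - p) := by
          gcongr ?_ * ?_
          exact Real.rpow_le_rpow_of_nonpos hL h.le (by linarith)

section Weak

variable {X : Type*} [TopologicalSpace X] [MeasurableSpace X]

/-- Lower semicontinuity of the integral of the positive part of a continuous function
under weak convergence. -/
theorem lintegral_ofReal_le_of_tendsto [OpensMeasurableSpace X] {ν : ℕ → FiniteMeasure X}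
    {ν' : FiniteMeasure X} (hν : Tendsto ν atTop (𝓝 ν')) {f : X → ℝ} (hf : Continuous f)
    {A : ℝ≥0∞} (hA : ∀ k, ∫⁻ x, ENNReal.ofReal (f x) ∂(ν k : Measure X) ≤ A) :
    ∫⁻ x, ENNReal.ofReal (f x) ∂(ν' : Measure X) ≤ A := by
  let g (n : ℕ) : X →ᵇ ℝ≥0 := BoundedContinuousFunction.mkOfBound
    ⟨fun x ↦ min (f x).toNNReal n, by fun_prop⟩ n fun x y ↦ by
      rw [NNReal.dist_eq]
      have h1 : ((min (f x).toNNReal n : ℝ≥0) : ℝ) ≤ n := by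
        exact_mod_cast min_le_right (f x).toNNReal (n : ℝ≥0)
      have h2 : ((min (f y).toNNReal n : ℝ≥0) : ℝ) ≤ n := by
        exact_mod_cast min_le_right (f y).toNNReal (n : ℝ≥0)
      exact abs_sub_le_of_nonneg_of_le (NNReal.coe_nonneg _) h1 (NNReal.coe_nonneg _) h2
  have hg (n : ℕ) (x : X) : (g n x : ℝ≥0∞) ≤ ENNReal.ofReal (f x) :=
    ENNReal.coe_le_coe.2 (min_le_left _ _)
  have hgA (n : ℕ) : ∫⁻ x, g n x ∂(ν' : Measure X) ≤ A :=
    le_of_tendsto' (FiniteMeasure.tendsto_iff_forall_lintegral_tendsto.1 hν (g n))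
      fun k ↦ (lintegral_mono (hg n)).trans (hA k)
  have hlim (x : X) : Tendsto (fun n ↦ (g n x : ℝ≥0∞)) atTop (𝓝 (ENNReal.ofReal (f x))) := by
    refine tendsto_const_nhds.congr' ?_
    filter_upwards [eventually_ge_atTop ⌈(f x).toNNReal⌉₊] with n hn
    have hn' : (f x).toNNReal ≤ (n : ℝ≥0) := (Nat.le_ceil _).trans (by exact_mod_cast hn)
    exact congrArg ((↑) : ℝ≥0 → ℝ≥0∞) (min_eq_left hn').symm
  refine le_of_tendsto' (lintegral_tendsto_of_tendsto_of_monotone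
    (fun n ↦ (g n).continuous.measurable.coe_nnreal_ennreal.aemeasurable)
    (ae_of_all _ fun x m n hmn ↦ ?_) (ae_of_all _ hlim)) hgA
  exact ENNReal.coe_le_coe.2 (min_le_min_left _ (by exact_mod_cast hmn))

/-- Weak convergence passes to integrals of continuous functions with uniformly
bounded `p`-th moments, `p > 1`. -/
theorem tendsto_integral_of_rpow_bound [OpensMeasurableSpace X] {ν : ℕ → FiniteMeasure X}
    {ν' : FiniteMeasure X} (hν : Tendsto ν atTop (𝓝 ν')) {h : X → ℝ} (hh : Continuous h)
    {p A : ℝ} (hp : 1 < p) (hi : ∀ k, Integrable h (ν k : Measure X))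
    (hi' : Integrable h (ν' : Measure X))
    (hip : ∀ k, Integrable (fun x ↦ |h x| ^ p) (ν k : Measure X))
    (hip' : Integrable (fun x ↦ |h x| ^ p) (ν' : Measure X))
    (hA : ∀ k, ∫ x, |h x| ^ p ∂(ν k : Measure X) ≤ A)
    (hA' : ∫ x, |h x| ^ p ∂(ν' : Measure X) ≤ A) :
    Tendsto (fun k ↦ ∫ x, h x ∂(ν k : Measure X)) atTop (𝓝 (∫ x, h x ∂(ν' : Measure X))) := by
  have hlim : Tendsto (fun L : ℝ ↦ A * L ^ (1 - p)) atTop (𝓝 0) := by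
    have := (tendsto_rpow_neg_atTop (sub_pos.2 hp)).const_mul A
    simpa only [neg_sub, mul_zero] using this
  rw [Metric.tendsto_atTop']
  intro ε hε
  obtain ⟨L, hLε, hL⟩ := ((hlim.eventually_lt_const (show 0 < ε / 3 by positivity)).and
    (eventually_gt_atTop 0)).exists
  let g : X →ᵇ ℝ := BoundedContinuousFunction.ofNormedAddCommGroup
    (fun x ↦ max (-L) (min L (h x))) (by fun_prop) L fun x ↦ by
      rw [Real.norm_eq_abs, abs_le]
      exact ⟨le_max_left _ _, max_le (by linarith) (min_le_left _ _)⟩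
  have key (m : FiniteMeasure X) (h1 : Integrable h (m : Measure X))
      (h2 : Integrable (fun x ↦ |h x| ^ p) (m : Measure X))
      (h3 : ∫ x, |h x| ^ p ∂(m : Measure X) ≤ A) :
      |∫ x, h x ∂(m : Measure X) - ∫ x, g x ∂(m : Measure X)| < ε / 3 := by
    rw [← integral_sub h1 (g.integrable _)]
    calc |∫ x, (h x - g x) ∂(m : Measure X)|
        ≤ ∫ x, |h x - g x| ∂(m : Measure X) := abs_integral_le_integral_abs
      _ ≤ ∫ x, |h x| ^ p * L ^ (1 - p) ∂(m : Measure X) :=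
          integral_mono (h1.sub (g.integrable _)).abs (h2.mul_const _)
            fun x ↦ abs_sub_clamp_le hp hL (h x)
      _ = (∫ x, |h x| ^ p ∂(m : Measure X)) * L ^ (1 - p) := integral_mul_const _ _
      _ ≤ A * L ^ (1 - p) := by gcongr
      _ < ε / 3 := hLε
  obtain ⟨n, hn⟩ := Metric.tendsto_atTop'.1
    (FiniteMeasure.tendsto_iff_forall_integral_tendsto.1 hν g) (ε / 3) (by positivity)
  refine ⟨n, fun k hk ↦ ?_⟩
  have a1 := key (ν k) (hi k) (hip k) (hA k)
  have a2 := key ν' hi' hip' hA'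
  have a3 := hn k hk
  rw [Real.dist_eq] at a3 ⊢
  rw [abs_lt] at *
  constructor <;> linarith [a1.1, a1.2, a2.1, a2.2, a3.1, a3.2]

end Weak

section Tight

variable {E F : Type*} [MeasurableSpace E] [MetricSpace E] [CompleteSpace E]
  [SecondCountableTopology E] [BorelSpace E]

/-- The normalizations of a weakly convergent sequence of finite measures with nonzero limit
form a tight set. -/
theorem isTightMeasureSet_range_normalize [Nonempty E] {μ : ℕ → FiniteMeasure E}
    {μ' : FiniteMeasure E} (hμ : Tendsto μ atTop (𝓝 μ')) (h0 : μ' ≠ 0) :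
    IsTightMeasureSet (Set.range fun n ↦ ((μ n).normalize : Measure E)) := by
  have hc := (FiniteMeasure.tendsto_normalize_of_tendsto hμ h0).isCompact_insert_range
  refine (isTightMeasureSet_of_isCompact_closure (by rwa [hc.isClosed.closure_eq])).subset ?_
  rintro _ ⟨n, rfl⟩
  exact ⟨_, Set.mem_insert_of_mem _ ⟨n, rfl⟩, rfl⟩

variable [NormedAddCommGroup F] [ProperSpace F] [SecondCountableTopology F] [MeasurableSpace F]
  [BorelSpace F]

/-- Finite measures on a product whose first marginals converge weakly and whose second
marginals have bounded `p`-th moments have a weakly convergent subsequence. -/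
theorem exists_tendsto_subseq_of_map_fst_tendsto [Nonempty E]
    {ν : ℕ → FiniteMeasure (E × F)}
    {μ : FiniteMeasure E} (hμ : Tendsto (fun j ↦ (ν j).map Prod.fst) atTop (𝓝 μ))
    {p : ℝ} (hp : 0 < p) {A : ℝ≥0∞} (hAtop : A ≠ ∞)
    (hA : ∀ j, ∫⁻ z, ENNReal.ofReal (‖z.2‖ ^ p) ∂(ν j : Measure (E × F)) ≤ A) :
    ∃ js : ℕ → ℕ, StrictMono js ∧ ∃ ν' : FiniteMeasure (E × F),
      Tendsto (ν ∘ js) atTop (𝓝 ν') := by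
  have hmass (j : ℕ) : ((ν j).map Prod.fst).mass = (ν j).mass := by
    rw [FiniteMeasure.mass, FiniteMeasure.map_apply _ measurable_fst MeasurableSet.univ,
      Set.preimage_univ, FiniteMeasure.mass]
  have hm : Tendsto (fun j ↦ (ν j).mass) atTop (𝓝 μ.mass) := by
    simpa only [hmass] using hμ.mass
  by_cases h0 : μ = 0
  · refine ⟨id, strictMono_id, 0, ?_⟩
    exact FiniteMeasure.tendsto_zero_of_tendsto_zero_mass (by simpa [h0] using hm)
  have hm0 : 0 < μ.mass := pos_iff_ne_zero.2 (μ.mass_nonzero_iff.2 h0)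
  obtain ⟨c, hc, hcm⟩ := exists_between hm0
  obtain ⟨J, hJ⟩ := eventually_atTop.1 (hm.eventually_const_lt hcm)
  let Q (n : ℕ) : ProbabilityMeasure (E × F) := (ν (n + J)).normalize
  have hn0 (n : ℕ) : ν (n + J) ≠ 0 := by
    rw [← FiniteMeasure.mass_nonzero_iff]
    exact (hc.trans (hJ _ (by omega))).ne'
  have hQ (n : ℕ) : (Q n : Measure (E × F)) = (ν (n + J)).mass⁻¹ • (ν (n + J) : Measure _) :=
    FiniteMeasure.toMeasure_normalize_eq_of_nonzero _ (hn0 n)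
  have htight : IsTightMeasureSet {(P : Measure (E × F)) | P ∈ Set.range Q} := by
    refine IsTightMeasureSet.prodMk ?_ ?_
    · refine (isTightMeasureSet_range_normalize hμ h0).subset ?_
      rintro _ ⟨_, ⟨_, ⟨n, rfl⟩, rfl⟩, rfl⟩
      refine ⟨n + J, ?_⟩
      have : (ν (n + J)).map Prod.fst ≠ 0 := by
        rw [← FiniteMeasure.mass_nonzero_iff, hmass, FiniteMeasure.mass_nonzero_iff]
        exact hn0 n
      simp only
      rw [FiniteMeasure.toMeasure_normalize_eq_of_nonzero _ this, hmass, hQ, Measure.fst,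
        Measure.map_smul, FiniteMeasure.toMeasure_map]
    · rw [isTightMeasureSet_iff_exists_isCompact_measure_compl_le]
      intro ε hε
      have hlim : Tendsto (fun R : ℝ ↦ (c : ℝ≥0∞)⁻¹ * (A / ENNReal.ofReal (R ^ p)))
          atTop (𝓝 0) := by
        have h1 : Tendsto (fun R : ℝ ↦ A / ENNReal.ofReal (R ^ p)) atTop (𝓝 0) := by
          have h2 := (ENNReal.tendsto_ofReal_atTop.comp (tendsto_rpow_atTop hp)).inv
          simpa [div_eq_mul_inv] using ENNReal.Tendsto.const_mul h2 (Or.inr hAtop)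
        simpa using ENNReal.Tendsto.const_mul (a := (c : ℝ≥0∞)⁻¹) h1 (Or.inr (by simp [hc.ne']))
      obtain ⟨R, hRε, hR⟩ := ((hlim.eventually_lt_const hε).and (eventually_gt_atTop 0)).exists
      refine ⟨Metric.closedBall 0 R, isCompact_closedBall _ _, ?_⟩
      rintro _ ⟨_, ⟨_, ⟨n, rfl⟩, rfl⟩, rfl⟩
      rw [Measure.snd_apply Metric.isClosed_closedBall.measurableSet.compl, hQ,
        Measure.smul_apply]
      refine le_trans ?_ hRε.le
      rw [ENNReal.smul_def, smul_eq_mul]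
      gcongr
      · rw [ENNReal.coe_inv (FiniteMeasure.mass_nonzero_iff _ |>.2 (hn0 n))]
        gcongr
        exact (hJ _ (by omega)).le
      · rw [ENNReal.le_div_iff_mul_le (Or.inl (by simp; positivity)) (Or.inl (by simp)), mul_comm]
        refine le_trans ?_ (hA (n + J))
        refine le_trans ?_ (mul_meas_ge_le_lintegral (by fun_prop) (ENNReal.ofReal (R ^ p)))
        gcongr
        intro z hz
        simp only [Set.mem_preimage, Set.mem_compl_iff, Metric.mem_closedBall, dist_zero_right,
          not_le] at hz
        exact ENNReal.ofReal_le_ofReal (Real.rpow_le_rpow hR.le hz.le hp.le)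
  obtain ⟨Q', -, φ, hφ, hlim⟩ := (isCompact_closure_of_isTightMeasureSet htight).tendsto_subseq
    (x := Q) fun n ↦ subset_closure ⟨n, rfl⟩
  refine ⟨fun k ↦ φ k + J, fun a b hab ↦ Nat.add_lt_add_right (hφ hab) J,
    μ.mass • Q'.toFiniteMeasure, ?_⟩
  have hsub : Tendsto (fun k ↦ (ν (φ k + J)).mass) atTop (𝓝 μ.mass) :=
    hm.comp ((tendsto_add_atTop_nat J).comp hφ.tendsto_atTop)
  have heq (k : ℕ) : (ν ∘ fun k ↦ φ k + J) k = (ν (φ k + J)).mass • (Q (φ k)).toFiniteMeasure :=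
    FiniteMeasure.self_eq_mass_smul_normalize _
  rw [funext heq, FiniteMeasure.tendsto_iff_forall_testAgainstNN_tendsto]
  intro f
  simp only [FiniteMeasure.smul_testAgainstNN_apply]
  exact hsub.smul (FiniteMeasure.tendsto_iff_forall_testAgainstNN_tendsto.1
    (ProbabilityMeasure.tendsto_nhds_iff_toFiniteMeasure_tendsto_nhds _ |>.1 hlim) f)

end Tight

/-- The `p`-th moment of the norm controls the first one on a finite measure space. -/
theorem integrable_of_integrable_norm_rpow {X F : Type*} [MeasurableSpace X]
    [NormedAddCommGroup F] {m : Measure X} [IsFiniteMeasure m] {f : X → F} {p : ℝ} (hp : 1 < p)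
    (hf : AEStronglyMeasurable f m) (hi : Integrable (fun x ↦ ‖f x‖ ^ p) m) :
    Integrable f m := by
  refine ((integrable_const (1 : ℝ)).add hi).mono' hf (ae_of_all _ fun x ↦ ?_)
  simp only [Pi.add_apply]
  rcases le_total ‖f x‖ 1 with h | h
  · linarith [Real.rpow_nonneg (norm_nonneg (f x)) p]
  · linarith [Real.self_le_rpow_of_one_le h hp.le]

section Barycenter

variable {E F : Type*} [MeasurableSpace E] [NormedAddCommGroup F] [NormedSpace ℝ F]
  [CompleteSpace F] [SecondCountableTopology F] [MeasurableSpace F] [BorelSpace F]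

/-- **Jensen's inequality** for the barycenters of a disintegration. -/
theorem integrable_norm_rpow_integral_condKernel {ν : Measure (E × F)} [IsFiniteMeasure ν] {p : ℝ}
    (hp : 1 < p) (hi : Integrable (fun z : E × F ↦ ‖z.2‖ ^ p) ν) :
    Integrable (fun x ↦ ‖∫ v, v ∂(ν.condKernel x)‖ ^ p) ν.fst ∧
      ∫ x, ‖∫ v, v ∂(ν.condKernel x)‖ ^ p ∂ν.fst ≤ ∫ z, ‖z.2‖ ^ p ∂ν := by
  have hi1 : Integrable (fun z : E × F ↦ z.2) ν :=
    integrable_of_integrable_norm_rpow hp measurable_snd.aestronglyMeasurable hi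
  have hle : ∀ᵐ x ∂ν.fst,
      ‖∫ v, v ∂(ν.condKernel x)‖ ^ p ≤ ∫ v, ‖v‖ ^ p ∂(ν.condKernel x) := by
    filter_upwards [hi.condKernel_ae, hi1.condKernel_ae] with x h1 h2
    calc ‖∫ v, v ∂(ν.condKernel x)‖ ^ p ≤ (∫ v, ‖v‖ ∂(ν.condKernel x)) ^ p := by
          gcongr
          exact norm_integral_le_integral_norm _
      _ ≤ ∫ v, ‖v‖ ^ p ∂(ν.condKernel x) :=
          (convexOn_rpow hp.le).map_integral_le
            (Real.continuous_rpow_const (by linarith)).continuousOn isClosed_Ici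
            (ae_of_all _ fun v ↦ norm_nonneg v) h2.norm h1
  have hint : Integrable (fun x ↦ ∫ v, ‖v‖ ^ p ∂(ν.condKernel x)) ν.fst := hi.integral_condKernel
  have hG : Integrable (fun x ↦ ‖∫ v, v ∂(ν.condKernel x)‖ ^ p) ν.fst := by
    refine hint.mono' ?_ ?_
    · have : AEStronglyMeasurable (fun x ↦ ∫ v, v ∂(ν.condKernel x)) ν.fst :=
        hi1.1.integral_condKernel
      exact (this.norm.aemeasurable.pow_const p).aestronglyMeasurable
    · filter_upwards [hle] with x hx
      rwa [Real.norm_of_nonneg (by positivity)]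
  refine ⟨hG, (integral_mono_ae hG hint hle).trans_eq ?_⟩
  exact Measure.integral_condKernel hi

end Barycenter

/-- **Weak compactness of uniformly `L^p`-bounded vector fields over weakly
converging measures.** If finite Borel measures `μ_j → μ` weakly on `ℝ^N`,
`1 < p < ∞`, and the measurable vector fields `F_j` satisfy
`‖F_j‖_{L^p(μ_j)} ≤ C`, then along a subsequence there is `F ∈ L^p(μ; ℝ^N)`
with `‖F‖_{L^p(μ)} ≤ C` such that `∫ φ F_{j_k} dμ_{j_k} → ∫ φ F dμ`
for every continuous compactly supported `φ`. -/
theorem Lp_vectorfield_weak_compactness (N : ℕ) (hN : 1 ≤ N)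
    (μs : ℕ → Measure (EuclideanSpace ℝ (Fin N)))
    (μ : Measure (EuclideanSpace ℝ (Fin N)))
    [∀ j, IsFiniteMeasure (μs j)] [IsFiniteMeasure μ]
    (hconv : ∀ g : BoundedContinuousFunction (EuclideanSpace ℝ (Fin N)) ℝ,
      Tendsto (fun j => ∫ x, g x ∂(μs j)) atTop (𝓝 (∫ x, g x ∂μ)))
    (p : ℝ) (hp : 1 < p) (C : ℝ) (hC : 0 < C)
    (F : ℕ → EuclideanSpace ℝ (Fin N) → EuclideanSpace ℝ (Fin N))
    (hFm : ∀ j, Measurable (F j))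
    (hFp : ∀ j, Integrable (fun x => ‖F j x‖ ^ p) (μs j))
    (hFb : ∀ j, (∫ x, ‖F j x‖ ^ p ∂(μs j)) ^ (1 / p) ≤ C) :
    ∃ js : ℕ → ℕ, StrictMono js ∧
      ∃ G : EuclideanSpace ℝ (Fin N) → EuclideanSpace ℝ (Fin N),
        AEStronglyMeasurable G μ ∧
        Integrable (fun x => ‖G x‖ ^ p) μ ∧
        (∫ x, ‖G x‖ ^ p ∂μ) ^ (1 / p) ≤ C ∧
        ∀ φ : EuclideanSpace ℝ (Fin N) → ℝ, Continuous φ → HasCompactSupport φ →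
          Tendsto (fun k => ∫ x, φ x • F (js k) x ∂(μs (js k))) atTop
            (𝓝 (∫ x, φ x • G x ∂μ)) := by
  have hp0 : 0 < p := by linarith
  have hgraph (j : ℕ) : Measurable fun x ↦ (x, F j x) := measurable_id.prodMk (hFm j)
  let ν (j : ℕ) : FiniteMeasure (EuclideanSpace ℝ (Fin N) × EuclideanSpace ℝ (Fin N)) :=
    ⟨(μs j).map fun x ↦ (x, F j x), inferInstance⟩
  have hν (j : ℕ) : (ν j).toMeasure = (μs j).map fun x ↦ (x, F j x) := rfl
  have hfst (j : ℕ) : ((ν j).map Prod.fst).toMeasure = μs j := by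
    rw [FiniteMeasure.toMeasure_map, hν, Measure.map_map measurable_fst (hgraph j)]
    exact Measure.map_id
  have hνint (j : ℕ) : Integrable (fun z : EuclideanSpace ℝ (Fin N) × EuclideanSpace ℝ (Fin N) ↦ ‖z.2‖ ^ p) (ν j).toMeasure :=
    (integrable_map_measure (by fun_prop (disch := positivity)) (hgraph j).aemeasurable).2 (hFp j)
  have hνle (j : ℕ) : ∫ z, ‖z.2‖ ^ p ∂(ν j).toMeasure ≤ C ^ p := by
    rw [hν, integral_map (hgraph j).aemeasurable (by fun_prop (disch := positivity))]
    have h0 : 0 ≤ ∫ x, ‖F j x‖ ^ p ∂(μs j) := integral_nonneg fun x ↦ by positivity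
    have := Real.rpow_le_rpow (by positivity) (hFb j) hp0.le
    rwa [one_div, Real.rpow_inv_rpow h0 hp0.ne'] at this
  have hνlint (j : ℕ) : ∫⁻ z, ENNReal.ofReal (‖z.2‖ ^ p) ∂(ν j).toMeasure ≤
      ENNReal.ofReal (C ^ p) := by
    rw [← ofReal_integral_eq_lintegral_ofReal (hνint j) (ae_of_all _ fun z ↦ by positivity)]
    exact ENNReal.ofReal_le_ofReal (hνle j)
  let μ' : FiniteMeasure (EuclideanSpace ℝ (Fin N)) := ⟨μ, inferInstance⟩
  have hμ : Tendsto (fun j ↦ (ν j).map Prod.fst) atTop (𝓝 μ') := by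
    rw [FiniteMeasure.tendsto_iff_forall_integral_tendsto]
    simp only [hfst]
    exact hconv
  obtain ⟨js, hjs, ν', hlim⟩ :=
    exists_tendsto_subseq_of_map_fst_tendsto hμ hp0 ENNReal.ofReal_ne_top hνlint
  have hν'fst : ν'.toMeasure.fst = μ := congrArg FiniteMeasure.toMeasure
    (tendsto_nhds_unique (FiniteMeasure.tendsto_map_of_tendsto_of_continuous _ _ hlim
      continuous_fst) (hμ.comp hjs.tendsto_atTop))
  have hν'lint : ∫⁻ z, ENNReal.ofReal (‖z.2‖ ^ p) ∂ν'.toMeasure ≤ ENNReal.ofReal (C ^ p) :=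
    lintegral_ofReal_le_of_tendsto hlim (f := fun z ↦ ‖z.2‖ ^ p)
      (continuous_snd.norm.rpow_const fun _ ↦ Or.inr hp0.le)
      fun k ↦ hνlint (js k)
  have hν'int : Integrable (fun z : EuclideanSpace ℝ (Fin N) × EuclideanSpace ℝ (Fin N) ↦ ‖z.2‖ ^ p) ν'.toMeasure := by
    refine ⟨by fun_prop (disch := positivity), (hasFiniteIntegral_iff_ofReal (ae_of_all _ fun z ↦ by positivity)).2 ?_⟩
    exact hν'lint.trans_lt ENNReal.ofReal_lt_top
  have hν'le : ∫ z, ‖z.2‖ ^ p ∂ν'.toMeasure ≤ C ^ p := by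
    rw [← ofReal_integral_eq_lintegral_ofReal hν'int (ae_of_all _ fun z ↦ by positivity)] at hν'lint
    exact (ENNReal.ofReal_le_ofReal_iff (by positivity)).1 hν'lint
  have hsnd : Integrable (fun z : EuclideanSpace ℝ (Fin N) × EuclideanSpace ℝ (Fin N) ↦ z.2) ν'.toMeasure :=
    integrable_of_integrable_norm_rpow hp measurable_snd.aestronglyMeasurable hν'int
  have hG := integrable_norm_rpow_integral_condKernel hp hν'int
  have hGm : AEStronglyMeasurable
      (fun x ↦ ∫ v, v ∂(ν'.toMeasure.condKernel x)) ν'.toMeasure.fst :=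
    hsnd.1.integral_condKernel
  rw [hν'fst] at hG hGm
  refine ⟨js, hjs, _, hGm, hG.1, ?_, fun φ hφ hφc ↦ ?_⟩
  · rw [one_div, Real.rpow_inv_le_iff_of_pos (integral_nonneg fun x ↦ by positivity) hC.le hp0]
    exact hG.2.trans hν'le
  · obtain ⟨M, hM⟩ := hφc.exists_bound_of_continuous hφ
    have hM0 : 0 ≤ M := (norm_nonneg _).trans (hM 0)
    have hvec (m : FiniteMeasure (EuclideanSpace ℝ (Fin N) × EuclideanSpace ℝ (Fin N)))
        (hm : Integrable (fun z : EuclideanSpace ℝ (Fin N) × EuclideanSpace ℝ (Fin N) ↦ ‖z.2‖ ^ p) m.toMeasure) :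
        Integrable (fun z : EuclideanSpace ℝ (Fin N) × EuclideanSpace ℝ (Fin N) ↦ φ z.1 • z.2) m.toMeasure :=
      (integrable_of_integrable_norm_rpow hp measurable_snd.aestronglyMeasurable hm).bdd_smul M
        (by fun_prop) (ae_of_all _ fun z ↦ hM z.1)
    have hl : ∫ x, φ x • (∫ v, v ∂(ν'.toMeasure.condKernel x)) ∂μ =
        ∫ z, φ z.1 • z.2 ∂ν'.toMeasure := by
      rw [← Measure.integral_condKernel (hvec ν' hν'int), hν'fst]
      exact integral_congr_ae (ae_of_all _ fun x ↦ (integral_smul (φ x) _).symm)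
    have hs (k : ℕ) : ∫ x, φ x • F (js k) x ∂(μs (js k)) =
        ∫ z, φ z.1 • z.2 ∂(ν (js k)).toMeasure := by
      rw [hν, integral_map (hgraph _).aemeasurable (by fun_prop)]
    simp only [hl, hs]
    rw [(EuclideanSpace.equiv (Fin N) ℝ).toHomeomorph.isInducing.tendsto_nhds_iff, tendsto_pi_nhds]
    intro i
    have hcoord (m : FiniteMeasure (EuclideanSpace ℝ (Fin N) × EuclideanSpace ℝ (Fin N)))
        (hm : Integrable (fun z : EuclideanSpace ℝ (Fin N) × EuclideanSpace ℝ (Fin N) ↦ ‖z.2‖ ^ p) m.toMeasure) :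
        (∫ z, φ z.1 • z.2 ∂m.toMeasure) i = ∫ z, φ z.1 * z.2 i ∂m.toMeasure :=
      ((EuclideanSpace.proj i : EuclideanSpace ℝ (Fin N) →L[ℝ] ℝ).integral_comp_comm (hvec m hm)).symm
    have hcoordi (m : FiniteMeasure (EuclideanSpace ℝ (Fin N) × EuclideanSpace ℝ (Fin N)))
        (hm : Integrable (fun z : EuclideanSpace ℝ (Fin N) × EuclideanSpace ℝ (Fin N) ↦ ‖z.2‖ ^ p) m.toMeasure) :
        Integrable (fun z : EuclideanSpace ℝ (Fin N) × EuclideanSpace ℝ (Fin N) ↦ φ z.1 * z.2 i) m.toMeasure :=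
      (EuclideanSpace.proj i : EuclideanSpace ℝ (Fin N) →L[ℝ] ℝ).integrable_comp (hvec m hm)
    have hbd (z : EuclideanSpace ℝ (Fin N) × EuclideanSpace ℝ (Fin N)) :
        |φ z.1 * z.2 i| ^ p ≤ M ^ p * ‖z.2‖ ^ p := by
      rw [← Real.mul_rpow hM0 (norm_nonneg _), abs_mul]
      gcongr
      · exact hM z.1
      · exact PiLp.norm_apply_le z.2 i
    have hcont : Continuous fun z : EuclideanSpace ℝ (Fin N) × EuclideanSpace ℝ (Fin N) ↦
        φ z.1 * z.2 i := by fun_prop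
    have hpow (m : FiniteMeasure (EuclideanSpace ℝ (Fin N) × EuclideanSpace ℝ (Fin N)))
        (hm : Integrable (fun z : EuclideanSpace ℝ (Fin N) × EuclideanSpace ℝ (Fin N) ↦ ‖z.2‖ ^ p) m.toMeasure)
        (hmC : ∫ z, ‖z.2‖ ^ p ∂m.toMeasure ≤ C ^ p) :
        Integrable (fun z : EuclideanSpace ℝ (Fin N) × EuclideanSpace ℝ (Fin N) ↦ |φ z.1 * z.2 i| ^ p) m.toMeasure ∧
          ∫ z, |φ z.1 * z.2 i| ^ p ∂m.toMeasure ≤ M ^ p * C ^ p := by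
      have h1 : Integrable (fun z : EuclideanSpace ℝ (Fin N) × EuclideanSpace ℝ (Fin N) ↦ |φ z.1 * z.2 i| ^ p) m.toMeasure := by
        refine (hm.const_mul (M ^ p)).mono'
          (hcont.abs.measurable.pow_const p).aestronglyMeasurable (ae_of_all _ fun z ↦ ?_)
        rw [Real.norm_of_nonneg (by positivity)]
        exact hbd z
      refine ⟨h1, (integral_mono h1 (hm.const_mul (M ^ p)) hbd).trans ?_⟩
      rw [integral_const_mul]
      gcongr
    have := tendsto_integral_of_rpow_bound hlim hcont hp
      (fun k ↦ hcoordi _ (hνint (js k))) (hcoordi _ hν'int)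
      (fun k ↦ (hpow _ (hνint (js k)) (hνle (js k))).1) (hpow _ hν'int hν'le).1
      (fun k ↦ (hpow _ (hνint (js k)) (hνle (js k))).2) (hpow _ hν'int hν'le).2
    rw [← hcoord _ hν'int] at this
    exact this.congr fun k ↦ (hcoord _ (hνint (js k))).symm
end
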